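/- For all real α > -1 and -1/2 < β ≤ 0, define for each integer n ≥ 0 the number ρ_n = h(1)^{-2}·√( ((α+β+2)_n·(α+β+2)_{n+1}) / ((β+1)_n·(β+1)_{n+1}) )·∫₀¹ (h(1)-h(r))·r^{β+n}(1-r)^α dr (this is the n-th singular value s_n(R_{α,β}) of the operator R_{α,β} = ℙ_{α,β}∘𝒞∘ℙ_{α,β}). Then lim_{n→∞} n^{α+1}·ρ_n = Γ(2α+2)/(Γ(α+2)·𝓑(α+1,β+1)). -/

import Mathlib

open MeasureTheory Real Filter

/-- The Beta function. -/
noncomputable def Beta (a b : ℝ) : ℝ := Real.Gamma a * Real.Gamma b / Real.Gamma (a + b)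

/-- The incomplete beta function h(r) = ∫₀^r t^β (1-t)^α dt. -/
noncomputable def hfun (α β : ℝ) (r : ℝ) : ℝ := ∫ t in (0:ℝ)..r, t ^ β * (1 - t) ^ α

/-- The ascending factorial (Pochhammer symbol) (a)_n. -/
noncomputable def poch (a : ℝ) (n : ℕ) : ℝ := Polynomial.eval a (ascPochhammer ℝ n)

/-- ρ_n = s_n(R_{α,β}), the singular values of R_{α,β} = ℙ_{α,β}∘𝒞∘ℙ_{α,β}. -/
noncomputable def rho (α β : ℝ) (n : ℕ) : ℝ :=
  (hfun α β 1)⁻¹ ^ 2 *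
    Real.sqrt ((poch (α+β+2) n * poch (α+β+2) (n+1)) / (poch (β+1) n * poch (β+1) (n+1))) *
    ∫ r in (0:ℝ)..1, (hfun α β 1 - hfun α β r) * r ^ (β + (n:ℝ)) * (1 - r) ^ α

/-- The real Beta integrand is integrable on `[0, 1]`, with integral `Beta u v`. -/
lemma intervalIntegrable_beta_and_integral {u v : ℝ} (hu : 0 < u) (hv : 0 < v) :
    IntervalIntegrable (fun x : ℝ => x ^ (u - 1) * (1 - x) ^ (v - 1)) volume 0 1 ∧
      ∫ x in (0:ℝ)..1, x ^ (u - 1) * (1 - x) ^ (v - 1) = Beta u v := by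
  have hcongr : Set.EqOn (fun x : ℝ => (x : ℂ) ^ ((u : ℂ) - 1) * (1 - (x : ℂ)) ^ ((v : ℂ) - 1))
      (fun x : ℝ => ((x ^ (u - 1) * (1 - x) ^ (v - 1) : ℝ) : ℂ)) (Set.uIoc 0 1) := by
    intro x hx
    rw [Set.uIoc_of_le zero_le_one] at hx
    have h1 : (0:ℝ) ≤ 1 - x := by linarith [hx.2]
    simp only
    rw [Complex.ofReal_mul, Complex.ofReal_cpow hx.1.le, Complex.ofReal_cpow h1]
    push_cast
    rfl
  have hconv := Complex.betaIntegral_convergent (u := (u : ℂ)) (v := (v : ℂ)) (by simpa) (by simpa)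
  have hbeta := hconv.congr hcongr
  constructor
  · rw [intervalIntegrable_iff] at hbeta ⊢
    simpa using! Integrable.re hbeta
  · have h := ProbabilityTheory.beta_eq_betaIntegralReal u v hu hv
    have e : Complex.betaIntegral u v
        = ((∫ x in (0:ℝ)..1, x ^ (u - 1) * (1 - x) ^ (v - 1) : ℝ) : ℂ) := by
      rw [← intervalIntegral.integral_ofReal, Complex.betaIntegral]
      refine intervalIntegral.integral_congr_ae (ae_of_all _ fun x hx => hcongr hx)
    rw [e, Complex.ofReal_re] at h
    exact h.symm

lemma poch_succ (a : ℝ) (n : ℕ) : poch a (n + 1) = poch a n * (a + n) :=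
  ascPochhammer_succ_eval n a

lemma poch_pos {a : ℝ} (ha : 0 < a) (n : ℕ) : 0 < poch a n := ascPochhammer_pos n a ha

lemma poch_eq_prod (a : ℝ) (n : ℕ) : poch a n = ∏ j ∈ Finset.range n, (a + j) := by
  induction n with
  | zero => simp [poch]
  | succ n ih => rw [poch_succ, ih, Finset.prod_range_succ]

lemma Gamma_add_nat {a : ℝ} (ha : 0 < a) (n : ℕ) :
    Real.Gamma (a + n) = Real.Gamma a * poch a n := by
  induction n with
  | zero => simp [poch]
  | succ n ih =>
    have : a + (n : ℝ) ≠ 0 := by positivity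
    rw [Nat.cast_succ, ← add_assoc, Real.Gamma_add_one this, ih, poch_succ]
    ring

lemma tendsto_rpow_mul_poch_succ_div {c d : ℝ} (hc : 0 < c) (hd : 0 < d) :
    Tendsto (fun n : ℕ => (n : ℝ) ^ d * (poch c (n + 1) / poch (c + d) (n + 1))) atTop
      (nhds (Real.Gamma (c + d) / Real.Gamma c)) := by
  have h := (Real.GammaSeq_tendsto_Gamma (c + d)).div (Real.GammaSeq_tendsto_Gamma c)
    (Real.Gamma_pos_of_pos hc).ne'
  refine h.congr' ?_
  filter_upwards [eventually_gt_atTop 0] with n hn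
  have hn' : (0 : ℝ) < n := by exact_mod_cast hn
  have h1 := poch_pos hc (n + 1)
  have h2 := poch_pos (add_pos hc hd) (n + 1)
  have h3 : (0 : ℝ) < n ^ c := Real.rpow_pos_of_pos hn' c
  have h4 : (0 : ℝ) < (n.factorial : ℝ) := by positivity
  simp only [Pi.div_apply, Real.GammaSeq, ← poch_eq_prod]
  rw [Real.rpow_add hn']
  field_simp

lemma tendsto_rpow_mul_poch_div {c d : ℝ} (hc : 0 < c) (hd : 0 < d) :
    Tendsto (fun n : ℕ => (n : ℝ) ^ d * (poch c n / poch (c + d) n)) atTop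
      (nhds (Real.Gamma (c + d) / Real.Gamma c)) := by
  have hinf : Tendsto (fun n : ℕ => c + (n : ℝ)) atTop atTop :=
    tendsto_atTop_add_const_left _ _ tendsto_natCast_atTop_atTop
  have hone : Tendsto (fun n : ℕ => 1 + d / (c + n)) atTop (nhds (1 + 0)) :=
    tendsto_const_nhds.add (hinf.const_div_atTop d)
  have h := (tendsto_rpow_mul_poch_succ_div hc hd).mul hone
  rw [add_zero, mul_one] at h
  refine h.congr fun n => ?_
  have h1 := poch_pos (add_pos hc hd) n
  have h2 : 0 < c + (n : ℝ) := by positivity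
  have h3 : 0 < c + d + (n : ℝ) := by positivity
  rw [poch_succ, poch_succ]
  field_simp
  ring

lemma tendsto_rpow_mul_Beta {c d : ℝ} (hc : 0 < c) (hd : 0 < d) :
    Tendsto (fun n : ℕ => (n : ℝ) ^ d * Beta (c + n) d) atTop (nhds (Real.Gamma d)) := by
  have hGc := Real.Gamma_pos_of_pos hc
  have hGcd := Real.Gamma_pos_of_pos (add_pos hc hd)
  have h := (tendsto_rpow_mul_poch_div hc hd).const_mul
    (Real.Gamma d * (Real.Gamma c / Real.Gamma (c + d)))
  have e : Real.Gamma d * (Real.Gamma c / Real.Gamma (c + d)) *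
      (Real.Gamma (c + d) / Real.Gamma c) = Real.Gamma d := by field_simp
  rw [e] at h
  refine h.congr fun n => ?_
  have h1 := poch_pos (add_pos hc hd) n
  rw [Beta, add_right_comm, Gamma_add_nat hc, Gamma_add_nat (add_pos hc hd)]
  field_simp

lemma hfun_one_sub_bounds {α β : ℝ} (hα : -1 < α) (hβ1 : -1 < β) (hβ2 : β ≤ 0) {r : ℝ}
    (hr : r ∈ Set.Ioo (0:ℝ) 1) :
    (1 - r) ^ (α + 1) / (α + 1) ≤ hfun α β 1 - hfun α β r ∧
      hfun α β 1 - hfun α β r ≤ r ^ β * ((1 - r) ^ (α + 1) / (α + 1)) := by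
  have hbeta : IntervalIntegrable (fun t : ℝ => t ^ β * (1 - t) ^ α) volume 0 1 := by
    simpa using (intervalIntegrable_beta_and_integral (u := β + 1) (v := α + 1)
      (by linarith) (by linarith)).1
  have hsub0 : Set.uIcc 0 r ⊆ Set.uIcc (0:ℝ) 1 :=
    Set.uIcc_subset_uIcc_left (by rw [Set.uIcc_of_le zero_le_one]; exact ⟨hr.1.le, hr.2.le⟩)
  have hsub1 : Set.uIcc r 1 ⊆ Set.uIcc (0:ℝ) 1 :=
    Set.uIcc_subset_uIcc_right (by rw [Set.uIcc_of_le zero_le_one]; exact ⟨hr.1.le, hr.2.le⟩)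
  have hi1 := hbeta.mono_set hsub1
  have hsplit : hfun α β 1 - hfun α β r = ∫ t in r..1, t ^ β * (1 - t) ^ α :=
    intervalIntegral.integral_interval_sub_left hbeta (hbeta.mono_set hsub0)
  have hpow : IntervalIntegrable (fun t : ℝ => (1 - t) ^ α) volume r 1 := by
    have h := (intervalIntegral.intervalIntegrable_rpow' (a := 1 - r) (b := 0) hα).comp_sub_left 1
    simpa using h
  have hval : ∫ t in r..1, (1 - t) ^ α = (1 - r) ^ (α + 1) / (α + 1) := by
    rw [intervalIntegral.integral_comp_sub_left (fun t : ℝ => t ^ α) 1, sub_self,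
      integral_rpow (Or.inl hα), Real.zero_rpow (by linarith), sub_zero]
  rw [hsplit, ← hval, ← intervalIntegral.integral_const_mul]
  constructor
  · refine intervalIntegral.integral_mono_on_of_le_Ioo hr.2.le hpow hi1 fun t ht => ?_
    have h0 : 0 < t := hr.1.trans ht.1
    exact le_mul_of_one_le_left (Real.rpow_nonneg (by linarith [ht.2]) _)
      (Real.one_le_rpow_of_pos_of_le_one_of_nonpos h0 ht.2.le hβ2)
  · refine intervalIntegral.integral_mono_on_of_le_Ioo hr.2.le hi1 (hpow.const_mul _)
      fun t ht => ?_
    exact mul_le_mul_of_nonneg_right (Real.rpow_le_rpow_of_nonpos hr.1 ht.1.le hβ2)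
      (Real.rpow_nonneg (by linarith [ht.2]) _)

lemma integral_hfun_bounds {α β : ℝ} (hα : -1 < α) (hβ1 : -(1 / 2 : ℝ) < β) (hβ2 : β ≤ 0)
    (n : ℕ) :
    Beta (β + 1 + n) (2 * α + 2) / (α + 1) ≤
        ∫ r in (0:ℝ)..1, (hfun α β 1 - hfun α β r) * r ^ (β + (n:ℝ)) * (1 - r) ^ α ∧
      ∫ r in (0:ℝ)..1, (hfun α β 1 - hfun α β r) * r ^ (β + (n:ℝ)) * (1 - r) ^ α ≤
        Beta (2 * β + 1 + n) (2 * α + 2) / (α + 1) := by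
  have hn : (0 : ℝ) ≤ n := n.cast_nonneg
  obtain ⟨hl, hl'⟩ := intervalIntegrable_beta_and_integral (u := β + 1 + n) (v := 2 * α + 2)
    (by linarith) (by linarith)
  obtain ⟨hu, hu'⟩ := intervalIntegrable_beta_and_integral (u := 2 * β + 1 + n) (v := 2 * α + 2)
    (by linarith) (by linarith)
  have hm := (intervalIntegrable_beta_and_integral (u := β + 1 + n) (v := α + 1)
    (by linarith) (by linarith)).1
  have hbeta : IntervalIntegrable (fun t : ℝ => t ^ β * (1 - t) ^ α) volume 0 1 := by
    simpa using (intervalIntegrable_beta_and_integral (u := β + 1) (v := α + 1)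
      (by linarith) (by linarith)).1
  have hcont : ContinuousOn (fun r => hfun α β 1 - hfun α β r) (Set.uIcc 0 1) :=
    continuousOn_const.sub
      (intervalIntegral.continuousOn_primitive_interval' hbeta Set.left_mem_uIcc)
  have hI : IntervalIntegrable
      (fun r => (hfun α β 1 - hfun α β r) * r ^ (β + (n:ℝ)) * (1 - r) ^ α) volume 0 1 := by
    refine (hm.continuousOn_mul hcont).congr fun x _ => ?_
    rw [mul_assoc, show β + (n:ℝ) = β + 1 + n - 1 by ring, show α = α + 1 - 1 by ring]
    simp only [sub_add_cancel]
  rw [← hl', ← hu', ← intervalIntegral.integral_div, ← intervalIntegral.integral_div]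
  constructor
  · refine intervalIntegral.integral_mono_on_of_le_Ioo zero_le_one (hl.div_const _) hI
      fun r hr => ?_
    have h1r : 0 < 1 - r := by linarith [hr.2]
    have hb := (hfun_one_sub_bounds hα (by linarith) hβ2 hr).1
    calc r ^ (β + 1 + n - 1) * (1 - r) ^ (2 * α + 2 - 1) / (α + 1)
        = (1 - r) ^ (α + 1) / (α + 1) * r ^ (β + (n:ℝ)) * (1 - r) ^ α := by
          rw [show β + 1 + n - 1 = β + (n:ℝ) by ring,
            show 2 * α + 2 - 1 = (α + 1) + α by ring, Real.rpow_add h1r]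
          ring
      _ ≤ _ := by have := hr.1; gcongr
  · refine intervalIntegral.integral_mono_on_of_le_Ioo zero_le_one hI (hu.div_const _)
      fun r hr => ?_
    have h1r : 0 < 1 - r := by linarith [hr.2]
    have hb := (hfun_one_sub_bounds hα (by linarith) hβ2 hr).2
    calc _ ≤ r ^ β * ((1 - r) ^ (α + 1) / (α + 1)) * r ^ (β + (n:ℝ)) * (1 - r) ^ α := by
          have := hr.1; gcongr
      _ = r ^ (2 * β + 1 + n - 1) * (1 - r) ^ (2 * α + 2 - 1) / (α + 1) := by
          rw [show 2 * β + 1 + n - 1 = β + (β + (n:ℝ)) by ring,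
            show 2 * α + 2 - 1 = (α + 1) + α by ring, Real.rpow_add h1r (α + 1) α, Real.rpow_add hr.1 β (β + n)]
          ring

lemma tendsto_rpow_mul_integral_hfun {α β : ℝ} (hα : -1 < α) (hβ1 : -(1 / 2 : ℝ) < β)
    (hβ2 : β ≤ 0) :
    Tendsto (fun n : ℕ => (n : ℝ) ^ (2 * α + 2) *
      ∫ r in (0:ℝ)..1, (hfun α β 1 - hfun α β r) * r ^ (β + (n:ℝ)) * (1 - r) ^ α) atTop
      (nhds (Real.Gamma (2 * α + 2) / (α + 1))) := by
  have hl := (tendsto_rpow_mul_Beta (c := β + 1) (d := 2 * α + 2)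
    (by linarith) (by linarith)).div_const (α + 1)
  have hu := (tendsto_rpow_mul_Beta (c := 2 * β + 1) (d := 2 * α + 2)
    (by linarith) (by linarith)).div_const (α + 1)
  refine tendsto_of_tendsto_of_tendsto_of_le_of_le hl hu (fun n => ?_) fun n => ?_
  · simp only
    rw [mul_div_assoc]
    exact mul_le_mul_of_nonneg_left (integral_hfun_bounds hα hβ1 hβ2 n).1 (by positivity)
  · simp only
    rw [mul_div_assoc]
    exact mul_le_mul_of_nonneg_left (integral_hfun_bounds hα hβ1 hβ2 n).2 (by positivity)

/-- lim_{n→∞} n^{α+1}·s_n(R_{α,β}) = Γ(2α+2)/(Γ(α+2)𝓑(α+1,β+1)). -/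
theorem singular_values_R_asymptotics (α β : ℝ) (hα : -1 < α) (hβ1 : -(1/2 : ℝ) < β)
    (hβ2 : β ≤ 0) :
    Tendsto (fun n : ℕ => (n:ℝ) ^ (α + 1) * rho α β n) atTop
      (nhds (Real.Gamma (2*α + 2) / (Real.Gamma (α + 2) * Beta (α+1) (β+1)))) := by
  have ha : 0 < α + 1 := by linarith
  have hb : 0 < β + 1 := by linarith
  have hab : 0 < α + β + 2 := by linarith
  have hsum : β + 1 + (α + 1) = α + β + 2 := by ring
  have hGa := Real.Gamma_pos_of_pos ha
  have hGb := Real.Gamma_pos_of_pos hb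
  have hGab := Real.Gamma_pos_of_pos hab
  have hL : 0 < Real.Gamma (α + β + 2) / Real.Gamma (β + 1) := by positivity
  have hone : hfun α β 1 = Beta (α + 1) (β + 1) := by
    have h := (intervalIntegrable_beta_and_integral hb ha).2
    simp only [add_sub_cancel_right] at h
    rw [hfun, h, Beta, Beta, mul_comm, add_comm (β + 1)]
  have h0 := tendsto_rpow_mul_poch_div hb ha
  have h1 := tendsto_rpow_mul_poch_succ_div hb ha
  rw [hsum] at h0 h1
  have hsqrt := (h0.mul h1).sqrt
  rw [Real.sqrt_mul_self hL.le] at hsqrt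
  have h := ((hsqrt.inv₀ hL.ne').mul (tendsto_rpow_mul_integral_hfun hα hβ1 hβ2)).const_mul
    ((hfun α β 1)⁻¹ ^ 2)
  have hlim : (hfun α β 1)⁻¹ ^ 2 * ((Real.Gamma (α + β + 2) / Real.Gamma (β + 1))⁻¹ *
      (Real.Gamma (2 * α + 2) / (α + 1))) =
      Real.Gamma (2*α + 2) / (Real.Gamma (α + 2) * Beta (α+1) (β+1)) := by
    rw [hone, Beta, show α + 2 = α + 1 + 1 by ring, Real.Gamma_add_one ha.ne',
      show α + 1 + (β + 1) = α + β + 2 by ring]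
    field_simp
  rw [hlim] at h
  refine h.congr' ?_
  filter_upwards [eventually_gt_atTop 0] with n hn
  have hn' : (0 : ℝ) < n := by exact_mod_cast hn
  have hna : (0 : ℝ) < n ^ (α + 1) := Real.rpow_pos_of_pos hn' _
  have p1 := poch_pos hb n
  have p2 := poch_pos hb (n + 1)
  have p3 := poch_pos hab n
  have p4 := poch_pos hab (n + 1)
  have hroot : (Real.sqrt ((n : ℝ) ^ (α + 1) * (poch (β + 1) n / poch (α + β + 2) n) *
      ((n : ℝ) ^ (α + 1) * (poch (β + 1) (n + 1) / poch (α + β + 2) (n + 1)))))⁻¹ =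
      ((n : ℝ) ^ (α + 1))⁻¹ * Real.sqrt ((poch (α+β+2) n * poch (α+β+2) (n+1)) /
        (poch (β+1) n * poch (β+1) (n+1))) := by
    rw [← Real.sqrt_inv]
    rw [show ((n : ℝ) ^ (α + 1) * (poch (β + 1) n / poch (α + β + 2) n) *
      ((n : ℝ) ^ (α + 1) * (poch (β + 1) (n + 1) / poch (α + β + 2) (n + 1))))⁻¹ =
      (((n : ℝ) ^ (α + 1))⁻¹) ^ 2 * ((poch (α+β+2) n * poch (α+β+2) (n+1)) /
        (poch (β+1) n * poch (β+1) (n+1))) by field_simp,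
      Real.sqrt_mul (by positivity), Real.sqrt_sq (by positivity)]
  rw [hroot, rho, show 2 * α + 2 = (α + 1) + (α + 1) by ring, Real.rpow_add hn' (α + 1)]
  generalize (n : ℝ) ^ (α + 1) = A at hna ⊢
  field_simp
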